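/- Let A and B be nontrivial groups. If the free product A ∗ B can be generated by two elements, then each of A and B is cyclic, i.e. each can be generated by a single element. -/

import Mathlib

open Monoid

namespace Grushko

/-- The subgroupoid, with object set `V` and labels in a group `G`, generated by a set `X` of
labelled arrows: `Path X p g q` says that `g` labels an arrow from `p` to `q`. -/
inductive Path {V G : Type*} [Group G] (X : V → G → V → Prop) : V → G → V → Prop
  | of {p g q} : X p g q → Path X p g q
  | one (p) : Path X p 1 p
  | mul {p g q h r} : Path X p g q → Path X q h r → Path X p (g * h) r
  | inv {p g q} : Path X p g q → Path X q g⁻¹ p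

/-- The labelled arrows listed in `L`. -/
def arrows {V G : Type*} (L : List (V × G × V)) (p : V) (g : G) (q : V) : Prop :=
  (p, g, q) ∈ L

/-- The union of families of arrows labelled in the factors of a free product. -/
def totalArrows {ι V : Type*} {G : ι → Type*} [∀ i, Group (G i)]
    (X : ∀ i, List (V × G i × V)) (p : V) (g : CoprodI G) (q : V) : Prop :=
  ∃ i c, (p, c, q) ∈ X i ∧ CoprodI.of c = g

section Path

variable {V W G H : Type*} [Group G] [Group H]

theorem Path.map {X : V → G → V → Prop} {Y : W → H → W → Prop} (π : V → W) (φ : G →* H)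
    (hXY : ∀ p g q, X p g q → Path Y (π p) (φ g) (π q)) {p : V} {g : G} {q : V}
    (h : Path X p g q) : Path Y (π p) (φ g) (π q) := by
  induction h with
  | of h => exact hXY _ _ _ h
  | one p => simpa using Path.one _
  | mul _ _ h₁ h₂ => simpa using h₁.mul h₂
  | inv _ h => simpa using h.inv

theorem Path.mono {X Y : V → G → V → Prop} (hXY : ∀ p g q, X p g q → Y p g q) {p : V} {g : G}
    {q : V} (h : Path X p g q) : Path Y p g q :=
  h.map id (MonoidHom.id G) fun _ _ _ hX => .of (hXY _ _ _ hX)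

theorem Path.iff_of_closed {X : V → G → V → Prop} {P : V → Prop}
    (hP : ∀ p g q, X p g q → (P p ↔ P q)) {p : V} {g : G} {q : V} (h : Path X p g q) :
    P p ↔ P q := by
  induction h with
  | of h => exact hP _ _ _ h
  | one p => rfl
  | mul _ _ h₁ h₂ => exact h₁.trans h₂
  | inv _ h => exact h.symm

theorem Path.mem_of_ne {X : V → G → V → Prop} {E : Set V}
    (hE : ∀ p g q, X p g q → p ∈ E ∧ q ∈ E) {p : V} {g : G} {q : V} (h : Path X p g q)
    (hpq : p ≠ q) : p ∈ E ∧ q ∈ E := by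
  have key : p = q ∨ p ∈ E ∧ q ∈ E := by
    clear hpq
    induction h with
    | of h => exact .inr (hE _ _ _ h)
    | one p => exact .inl rfl
    | mul _ _ h₁ h₂ => grind
    | inv _ h => grind
  exact key.resolve_left hpq

theorem Path.label_mem {X : V → G → V → Prop} (φ : G →* H) {K : Subgroup H}
    (hK : ∀ p g q, X p g q → φ g ∈ K) {p : V} {g : G} {q : V} (h : Path X p g q) : φ g ∈ K := by
  induction h with
  | of h => exact hK _ _ _ h
  | one p => simp
  | mul _ _ h₁ h₂ => simpa using K.mul_mem h₁ h₂
  | inv _ h => simpa using h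

/-- Identifying two objects joined by an arrow with trivial label saves one generator. -/
theorem exists_fold [DecidableEq V] {L : List (V × G × V)} {E : Finset V}
    (hE : ∀ t ∈ L, t.1 ∈ E ∧ t.2.2 ∈ E) {e f : V} (hef : e ≠ f) (h : Path (arrows L) e 1 f) :
    ∃ L' : List (V × G × V), L'.length + 1 = L.length ∧
      (∀ t ∈ L', t.1 ∈ E.erase f ∧ t.2.2 ∈ E.erase f) ∧
      ∀ p g q, Path (arrows L) p g q →
        Path (arrows L') (Function.update id f e p) g (Function.update id f e q) := by
  obtain ⟨t, htL, u, k, huf, ht⟩ :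
      ∃ t ∈ L, ∃ u k, u ≠ f ∧ (t = (u, k, f) ∨ t = (f, k⁻¹, u)) := by
    by_contra! hcon
    have := h.iff_of_closed (P := (· = f)) fun p g q hX => by
      by_cases hp : p = f <;> by_cases hq : q = f <;> simp only [hp, hq]
      · subst hp
        exact absurd (by simp) (hcon _ hX q g⁻¹ hq).2
      · subst hq
        exact absurd rfl (hcon _ hX p g hp).1
    exact hef (this.2 rfl)
  have huE : u ∈ E := by
    rcases ht with rfl | rfl
    · exact (hE _ htL).1
    · exact (hE _ htL).2
  obtain ⟨l₁, l₂, rfl⟩ := List.append_of_mem htL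
  let σ : V → V := Function.update id f u
  let τ : V → G := Function.update 1 f k
  have hσf : σ f = u := by simp [σ]
  have hτf : τ f = k := by simp [τ]
  have hσ : ∀ p, p ≠ f → σ p = p := fun p hp => by simp [σ, hp]
  have hτ : ∀ p, p ≠ f → τ p = 1 := fun p hp => by simp [τ, hp]
  have hσE : ∀ p ∈ E, σ p ∈ E.erase f := fun p hp => by
    by_cases hpf : p = f
    · subst hpf; simp [hσf, huf, huE]
    · simp [hσ p hpf, hpf, hp]
  let L' : List (V × G × V) :=
    (l₁ ++ l₂).map fun t => (σ t.1, τ t.1 * t.2.1 * (τ t.2.2)⁻¹, σ t.2.2)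
  have key : ∀ p g q, Path (arrows (l₁ ++ t :: l₂)) p g q →
      Path (arrows L') (σ p) (τ p * g * (τ q)⁻¹) (σ q) := by
    intro p g q hp
    induction hp with
    | @of p g q hX =>
      by_cases hpt : (p, g, q) = t
      · have h1 : σ p = σ q ∧ τ p * g * (τ q)⁻¹ = 1 := by
          rcases ht with ht | ht <;> rw [← hpt] at ht <;> obtain ⟨rfl, rfl, rfl⟩ := by simpa using ht
          · simp [hσf, hσ _ huf, hτf, hτ _ huf]
          · simp [hσf, hσ _ huf, hτf, hτ _ huf]
        rw [h1.1, h1.2]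
        exact .one _
      · refine .of (List.mem_map.2 ⟨(p, g, q), ?_, rfl⟩)
        simp only [arrows, List.mem_append, List.mem_cons, hpt, false_or] at hX
        exact List.mem_append.2 hX
    | one p => simpa using Path.one _
    | mul _ _ h₁ h₂ => simpa [mul_assoc] using h₁.mul h₂
    | inv _ h => simpa [mul_assoc] using h.inv
  have hbase : ∀ p, Path (arrows L') (Function.update id f e p) (τ p)⁻¹ (σ p) := by
    intro p
    by_cases hp : p = f
    · subst hp
      simpa [hτ e hef, hσ e hef, hσf] using key _ _ _ h
    · simpa [hτ p hp, hσ p hp, hp] using Path.one _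
  refine ⟨L', by simp [L']; omega, ?_, fun p g q hp => ?_⟩
  · intro s hs
    obtain ⟨s', hs', rfl⟩ := List.mem_map.1 hs
    have := hE s' (by simp only [List.mem_append, List.mem_cons] at hs' ⊢; tauto)
    exact ⟨hσE _ this.1, hσE _ this.2⟩
  · simpa [mul_assoc] using ((hbase p).mul (key p g q hp)).mul (hbase q).inv

end Path

section FreeProduct

variable {ι V : Type*} {G : ι → Type*} [∀ i, Group (G i)]

/-- `ReadsWord X p l q` says that the word `l` can be read along paths of the factors
from `p` to `q`. -/
def ReadsWord (X : ∀ i, List (V × G i × V)) : V → List (Σ i, G i) → V → Prop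
  | p, [], q => p = q
  | p, s :: l, q => ∃ r, Path (arrows (X s.1)) p s.2 r ∧ ReadsWord X r l q

theorem readsWord_rcons [DecidableEq ι] [∀ i, DecidableEq (G i)] {X : ∀ i, List (V × G i × V)}
    (hX : ∀ i e f, Path (arrows (X i)) e 1 f → e = f) {i : ι} (w : CoprodI.Word.Pair G i)
    (p q : V) : ReadsWord X p (CoprodI.Word.rcons w).toList q ↔
      ∃ r, Path (arrows (X i)) p w.head r ∧ ReadsWord X r w.tail.toList q := by
  by_cases h : w.head = 1
  · rw [CoprodI.Word.rcons, dif_pos h, h]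
    refine ⟨fun hp => ⟨p, .one p, hp⟩, ?_⟩
    rintro ⟨r, hr, hq⟩
    rwa [hX _ _ _ hr]
  · rw [CoprodI.Word.rcons, dif_neg h]
    rfl

theorem readsWord_smul [DecidableEq ι] [∀ i, DecidableEq (G i)] {X : ∀ i, List (V × G i × V)}
    (hX : ∀ i e f, Path (arrows (X i)) e 1 f → e = f) {i : ι} {p q r : V} {c : G i}
    (hc : Path (arrows (X i)) p c q) {w : CoprodI.Word G} (hw : ReadsWord X q w.toList r) :
    ReadsWord X p (CoprodI.of c • w).toList r := by
  rw [CoprodI.Word.of_smul_def, readsWord_rcons hX]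
  rw [← (CoprodI.Word.equivPair i).symm_apply_apply w, CoprodI.Word.equivPair_symm,
    readsWord_rcons hX] at hw
  obtain ⟨s, hs, hr⟩ := hw
  exact ⟨s, hc.mul hs, hr⟩

/-- If distinct objects are joined by an arrow with trivial label in the free product, then this
already happens in one of the factors. -/
theorem exists_path_one_of_total {X : ∀ i, List (V × G i × V)} {p q : V}
    (h : Path (totalArrows X) p 1 q) (hpq : p ≠ q) :
    ∃ i e f, e ≠ f ∧ Path (arrows (X i)) e 1 f := by
  classical
  by_contra! hcon
  have hX : ∀ i e f, Path (arrows (X i)) e 1 f → e = f := fun i e f h =>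
    by_contra fun hef => hcon i e f hef h
  have key : ∀ {p g q}, Path (totalArrows X) p g q → ∀ w : CoprodI.Word G,
      (∀ r, ReadsWord X q w.toList r → ReadsWord X p (g • w).toList r) ∧
      (∀ r, ReadsWord X p w.toList r → ReadsWord X q (g⁻¹ • w).toList r) := by
    intro p g q h
    induction h with
    | of h =>
      obtain ⟨i, c, hc, rfl⟩ := h
      refine fun w => ⟨fun r => readsWord_smul hX (.of hc), fun r hr => ?_⟩
      rw [← map_inv]
      exact readsWord_smul hX (Path.of hc).inv hr
    | one p => simp
    | mul _ _ h₁ h₂ =>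
      intro w
      simp only [mul_inv_rev, mul_smul]
      exact ⟨fun r hr => (h₁ _).1 _ ((h₂ _).1 _ hr), fun r hr => (h₂ _).2 _ ((h₁ _).2 _ hr)⟩
    | inv _ h =>
      intro w
      simpa using (h w).symm
  have h1 := (key h CoprodI.Word.empty).1 q rfl
  rw [one_smul] at h1
  exact hpq h1

theorem Path.total_mono {X Y : ∀ i, List (V × G i × V)} (h : ∀ i, X i ⊆ Y i) {p : V}
    {g : CoprodI G} {q : V} (hp : Path (totalArrows X) p g q) : Path (totalArrows Y) p g q :=
  hp.mono fun _ _ _ ⟨i, c, hc, hg⟩ => ⟨i, c, h i hc, hg⟩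

variable [Fintype ι]

/-- Folding: a generating graph of groupoid rank `n` produces generating lists of the factors of
total length at most `n`. -/
theorem exists_generators_of_graph [DecidableEq V] {n : ℕ} (E : Finset V) (hne : E.Nonempty)
    (X : ∀ i, List (V × G i × V)) (hE : ∀ i, ∀ t ∈ X i, t.1 ∈ E ∧ t.2.2 ∈ E)
    (hcard : ∑ i, (X i).length + 1 ≤ E.card + n)
    (hfull : ∀ p ∈ E, ∀ q ∈ E, ∀ g, Path (totalArrows X) p g q) :
    ∃ L : ∀ i, List (G i), (∀ i, Subgroup.closure {g | g ∈ L i} = ⊤) ∧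
      ∑ i, (L i).length ≤ n := by
  classical
  induction hk : E.card generalizing E X with
  | zero => simp_all
  | succ k ih =>
  obtain rfl | hk0 := Nat.eq_zero_or_pos k
  · obtain ⟨e, he⟩ := hne
    refine ⟨fun i => (X i).map fun t => t.2.1, fun i => ?_, by simp; omega⟩
    refine eq_top_iff.2 fun g _ => ?_
    let φ : CoprodI G →* G i := CoprodI.lift (Pi.mulSingle i (MonoidHom.id (G i)))
    have := (hfull e he e he (CoprodI.of g)).label_mem φ
      (K := Subgroup.closure {g | g ∈ (X i).map fun t => t.2.1}) ?_
    · simpa [φ] using this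
    · rintro p _ q ⟨j, c, hc, rfl⟩
      by_cases hij : j = i
      · subst hij
        refine Subgroup.subset_closure (List.mem_map.2 ⟨_, hc, ?_⟩)
        simp [φ]
      · simp [φ, hij]
  · obtain ⟨p, hp, q, hq, hpq⟩ := Finset.one_lt_card.1 (by omega : 1 < E.card)
    obtain ⟨i, e, f, hef, h⟩ := exists_path_one_of_total (hfull p hp q hq 1) hpq
    have hmem : e ∈ E ∧ f ∈ E := h.mem_of_ne (E := ↑E) (fun _ _ _ ht => hE i _ ht) hef
    let π : V → V := Function.update id f e
    have hπ : ∀ p ∈ E, π p ∈ E.erase f := fun p hp => by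
      by_cases hpf : p = f
      · subst hpf; simp [π, hef, hmem.1]
      · simp [π, hpf, hp]
    have hY : ∀ j, ∃ Y : List (V × G j × V),
        Y.length + (if j = i then 1 else 0) = (X j).length ∧
        (∀ t ∈ Y, t.1 ∈ E.erase f ∧ t.2.2 ∈ E.erase f) ∧
        ∀ p g q, Path (arrows (X j)) p g q → Path (arrows Y) (π p) g (π q) := by
      intro j
      by_cases hj : j = i
      · subst hj
        simpa using exists_fold (hE j) hef h
      · refine ⟨(X j).map fun t => (π t.1, t.2.1, π t.2.2), by simp [hj], ?_, fun p g q hp => ?_⟩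
        · intro t ht
          obtain ⟨s, hs, rfl⟩ := List.mem_map.1 ht
          exact ⟨hπ _ (hE j s hs).1, hπ _ (hE j s hs).2⟩
        · exact hp.map π (MonoidHom.id _) fun p g q hX => .of (List.mem_map.2 ⟨_, hX, rfl⟩)
    choose Y hlen hYE hYpath using hY
    have hcardE := Finset.card_erase_of_mem hmem.2
    refine ih (E.erase f) ⟨e, by simp [hef, hmem.1]⟩ Y hYE ?_ ?_ (by omega)
    · have : ∑ j, (Y j).length + 1 = ∑ j, (X j).length := by
        simp [← hlen, Finset.sum_add_distrib]
      omega
    · intro p hp q hq g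
      have hpath := (hfull p (Finset.mem_of_mem_erase hp) q (Finset.mem_of_mem_erase hq) g).map
        (Y := totalArrows Y) π (MonoidHom.id _) ?_
      · simpa [π, Finset.ne_of_mem_erase hp, Finset.ne_of_mem_erase hq] using hpath
      · rintro p _ q ⟨j, c, hc, rfl⟩
        exact (hYpath j p c q (.of hc)).map (Y := totalArrows Y) id CoprodI.of
          fun p g q hY => .of ⟨j, g, hY, rfl⟩

/-- A finite connected graph on `E` with edges labelled in the factors of a free product, of
groupoid rank at most `n`. -/
structure IsConnectedGraph (E : Finset V) (X : ∀ i, List (V × G i × V)) (n : ℕ) : Prop where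
  mem : ∀ i, ∀ t ∈ X i, t.1 ∈ E ∧ t.2.2 ∈ E
  card : ∑ i, (X i).length + 1 ≤ E.card + n
  conn : ∀ p ∈ E, ∀ q ∈ E, ∃ g, Path (totalArrows X) p g q

/-- Any element labels a path from a given vertex, after enlarging the graph without changing
its rank. -/
theorem IsConnectedGraph.exists_extend [Infinite V] (g : CoprodI G) {n : ℕ} {E : Finset V}
    {X : ∀ i, List (V × G i × V)} (h : IsConnectedGraph E X n) {p : V} (hp : p ∈ E) :
    ∃ (E' : Finset V) (X' : ∀ i, List (V × G i × V)), IsConnectedGraph E' X' n ∧ E ⊆ E' ∧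
      (∀ i, X i ⊆ X' i) ∧ ∃ q ∈ E', Path (totalArrows X') p g q := by
  classical
  induction g using CoprodI.induction_on generalizing E X p with
  | one => exact ⟨E, X, h, subset_rfl, fun i => List.Subset.refl _, p, hp, .one p⟩
  | of i c =>
    obtain ⟨q, hq⟩ := Infinite.exists_notMem_finset E
    have hY : ∀ j, ∃ Y : List (V × G j × V), X j ⊆ Y ∧
        Y.length = (X j).length + (if j = i then 1 else 0) ∧
        (∀ t ∈ Y, t.1 ∈ insert q E ∧ t.2.2 ∈ insert q E) ∧
        ∀ hj : j = i, (p, hj ▸ c, q) ∈ Y := by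
      intro j
      have hEj : ∀ t ∈ X j, t.1 ∈ insert q E ∧ t.2.2 ∈ insert q E := fun t ht =>
        ⟨Finset.mem_insert_of_mem (h.mem j t ht).1, Finset.mem_insert_of_mem (h.mem j t ht).2⟩
      by_cases hj : j = i
      · subst hj
        refine ⟨(p, c, q) :: X j, List.subset_cons_self _ _, by simp, ?_, by simp⟩
        simp only [List.mem_cons, forall_eq_or_imp]
        exact ⟨by simp [hp], hEj⟩
      · exact ⟨X j, List.Subset.refl _, by simp [hj], hEj, fun hj' => absurd hj' hj⟩
    choose Y hXY hlen hYE hYi using hY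
    have hpq : Path (totalArrows Y) p (CoprodI.of c) q := .of ⟨i, c, hYi i rfl, rfl⟩
    have hfrom : ∀ r ∈ insert q E, ∃ g, Path (totalArrows Y) p g r := by
      intro r hr
      obtain rfl | hr := Finset.mem_insert.1 hr
      · exact ⟨_, hpq⟩
      · obtain ⟨g, hg⟩ := h.conn p hp r hr
        exact ⟨g, Path.total_mono hXY hg⟩
    refine ⟨insert q E, Y, ⟨hYE, ?_, ?_⟩, Finset.subset_insert _ _, hXY, q, by simp, hpq⟩
    · have := h.card
      simp only [hlen, Finset.sum_add_distrib, Finset.sum_ite_eq', Finset.mem_univ, if_true,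
        Finset.card_insert_of_notMem hq]
      omega
    · intro r hr s hs
      obtain ⟨g, hg⟩ := hfrom r hr
      obtain ⟨g', hg'⟩ := hfrom s hs
      exact ⟨_, hg.inv.mul hg'⟩
  | mul x y hx hy =>
    obtain ⟨E₁, X₁, h₁, hE₁, hX₁, q, hq, hpq⟩ := hx h hp
    obtain ⟨E₂, X₂, h₂, hE₂, hX₂, r, hr, hqr⟩ := hy h₁ hq
    exact ⟨E₂, X₂, h₂, fun _ hs => hE₂ (hE₁ hs),
      fun i => List.Subset.trans (hX₁ i) (hX₂ i), r, hr,
      (Path.total_mono hX₂ hpq).mul hqr⟩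

/-- Any list of `n` elements is realised by loops in a graph of rank at most `n`. -/
theorem exists_connectedGraph [DecidableEq V] [Infinite V] (v : V) (S : List (CoprodI G)) :
    ∃ (E : Finset V) (X : ∀ i, List (V × G i × V)), IsConnectedGraph E X S.length ∧ v ∈ E ∧
      ∀ g ∈ S, Path (totalArrows X) v g v := by
  induction S with
  | nil =>
    refine ⟨{v}, fun _ => [], ⟨by simp, by simp, ?_⟩, by simp, by simp⟩
    intro p hp q hq
    rw [Finset.mem_singleton.1 hp, Finset.mem_singleton.1 hq]
    exact ⟨1, .one _⟩
  | cons g S ih =>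
    obtain ⟨E₀, X₀, h₀, hv₀, hS₀⟩ := ih
    obtain ⟨E, X, h, hE, hX, q, hq, hg⟩ := h₀.exists_extend g hv₀
    have hv := hE hv₀
    have hS : ∀ s ∈ S, Path (totalArrows X) v s v := fun s hs => Path.total_mono hX (hS₀ s hs)
    have hcard := h.card
    by_cases hqv : q = v
    · subst hqv
      refine ⟨E, X, ⟨h.mem, by simp; omega, h.conn⟩, hv, ?_⟩
      simpa using ⟨hg, hS⟩
    let π : V → V := Function.update id q v
    have hπ : ∀ p ∈ E, π p ∈ E.erase q := fun p hp => by
      by_cases hpq : p = q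
      · subst hpq; simp [π, Ne.symm hqv, hv]
      · simp [π, hpq, hp]
    have hπq : π q = v := by simp [π]
    have hπ' : ∀ p, p ≠ q → π p = p := fun p hp => by simp [π, hp]
    have hπv := hπ' v (Ne.symm hqv)
    let Y : ∀ i, List (V × G i × V) := fun i => (X i).map fun t => (π t.1, t.2.1, π t.2.2)
    have hXY : ∀ {p g r}, Path (totalArrows X) p g r → Path (totalArrows Y) (π p) g (π r) := by
      intro p g r hp
      refine hp.map π (MonoidHom.id _) ?_
      rintro p _ r ⟨i, c, hc, rfl⟩
      exact .of ⟨i, c, List.mem_map.2 ⟨_, hc, rfl⟩, rfl⟩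
    refine ⟨E.erase q, Y, ⟨?_, ?_, ?_⟩, by simp [Ne.symm hqv, hv], ?_⟩
    · intro i t ht
      obtain ⟨s, hs, rfl⟩ := List.mem_map.1 ht
      exact ⟨hπ _ (h.mem i s hs).1, hπ _ (h.mem i s hs).2⟩
    · have := Finset.card_erase_add_one hq
      simp only [Y, List.length_map, List.length_cons]
      omega
    · intro p hp r hr
      obtain ⟨c, hc⟩ := h.conn p (Finset.mem_of_mem_erase hp) r (Finset.mem_of_mem_erase hr)
      have := hXY hc
      rw [hπ' p (Finset.ne_of_mem_erase hp), hπ' r (Finset.ne_of_mem_erase hr)] at this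
      exact ⟨c, this⟩
    · simp only [List.mem_cons, forall_eq_or_imp]
      refine ⟨?_, fun s hs => ?_⟩
      · simpa only [hπv, hπq] using hXY hg
      · simpa only [hπv] using hXY (hS s hs)

/-- **Grushko's theorem**: if a finite free product is generated by `n` elements, then its factors
have generating lists of total length at most `n`. -/
theorem exists_generators_of_closure_eq_top (S : List (CoprodI G))
    (hS : Subgroup.closure {g | g ∈ S} = ⊤) :
    ∃ L : ∀ i, List (G i), (∀ i, Subgroup.closure {g | g ∈ L i} = ⊤) ∧
      ∑ i, (L i).length ≤ S.length := by
  obtain ⟨E, X, h, hv, hloop⟩ := exists_connectedGraph (0 : ℕ) S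
  have hall : ∀ g, Path (totalArrows X) 0 g 0 := by
    intro g
    have hg : g ∈ Subgroup.closure {g | g ∈ S} := hS ▸ Subgroup.mem_top g
    induction hg using Subgroup.closure_induction with
    | mem g hg => exact hloop g hg
    | one => exact .one _
    | mul _ _ _ _ h₁ h₂ => exact h₁.mul h₂
    | inv _ _ h => exact h.inv
  refine exists_generators_of_graph E ⟨0, hv⟩ X h.mem h.card fun p hp q hq g => ?_
  obtain ⟨c, hc⟩ := h.conn p hp 0 hv
  obtain ⟨d, hd⟩ := h.conn 0 hv q hq
  simpa [mul_assoc] using (hc.mul (hall (c⁻¹ * g * d⁻¹))).mul hd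

end FreeProduct

/-- The two factors of a binary free product as a family indexed by `Bool`. -/
abbrev Factor.{u, v} (A : Type u) (B : Type v) : Bool → Type (max u v)
  | true => ULift.{v} A
  | false => ULift.{u} B

instance {A B : Type*} [Group A] [Group B] : ∀ b, Group (Factor A B b)
  | true => inferInstanceAs (Group (ULift A))
  | false => inferInstanceAs (Group (ULift B))

/-- The comparison map from the binary free product to the free product of the family. -/
def toCoprodI (A B : Type*) [Group A] [Group B] : Coprod A B →* CoprodI (Factor A B) :=
  Coprod.lift
    ((CoprodI.of (M := Factor A B) (i := true)).comp MulEquiv.ulift.symm.toMonoidHom)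
    ((CoprodI.of (M := Factor A B) (i := false)).comp MulEquiv.ulift.symm.toMonoidHom)

theorem toCoprodI_surjective (A B : Type*) [Group A] [Group B] :
    Function.Surjective (toCoprodI A B) := by
  intro g
  induction g using CoprodI.induction_on with
  | one => exact ⟨1, map_one _⟩
  | of i c =>
    cases i with
    | true => exact ⟨Coprod.inl c.down, Coprod.lift_apply_inl _ _ _⟩
    | false => exact ⟨Coprod.inr c.down, Coprod.lift_apply_inr _ _ _⟩
  | mul x y hx hy =>
    obtain ⟨a, rfl⟩ := hx
    obtain ⟨b, rfl⟩ := hy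
    exact ⟨a * b, map_mul _ _ _⟩

theorem length_pos_of_closure_eq_top {G : Type*} [Group G] [Nontrivial G] {L : List G}
    (hL : Subgroup.closure {g | g ∈ L} = ⊤) : 0 < L.length := by
  refine List.length_pos_iff.2 fun h => ?_
  subst h
  simp at hL

theorem isCyclic_of_length_le_one {G : Type*} [Group G] {L : List G}
    (hL : Subgroup.closure {g | g ∈ L} = ⊤) (hlen : L.length ≤ 1) : IsCyclic G := by
  match L, hlen with
  | [], _ =>
    refine ⟨1, fun g => ?_⟩
    have : g ∈ Subgroup.closure {g : G | g ∈ []} := hL ▸ Subgroup.mem_top g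
    simpa [eq_comm] using this
  | [a], _ =>
    refine ⟨a, fun g => ?_⟩
    have : g ∈ Subgroup.closure {g : G | g ∈ [a]} := hL ▸ Subgroup.mem_top g
    simpa [Subgroup.mem_closure_singleton] using this

end Grushko

/-- If the free product `A ∗ B` of two nontrivial groups is generated by two elements,
then each of `A` and `B` is cyclic. -/
theorem free_product_two_generated_factors_cyclic
    {A B : Type*} [Group A] [Group B] [Nontrivial A] [Nontrivial B]
    (h : ∃ x y : Coprod A B, Subgroup.closure {x, y} = ⊤) :
    IsCyclic A ∧ IsCyclic B := by
  obtain ⟨x, y, hxy⟩ := h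
  obtain ⟨L, hL, hlen⟩ := Grushko.exists_generators_of_closure_eq_top
    [Grushko.toCoprodI A B x, Grushko.toCoprodI A B y] (by
      have := congrArg (Subgroup.map (Grushko.toCoprodI A B)) hxy
      rw [MonoidHom.map_closure, Set.image_pair,
        Subgroup.map_top_of_surjective _ (Grushko.toCoprodI_surjective A B)] at this
      rw [← this]
      congr 1
      ext
      simp)
  have hA : 0 < (L true).length :=
    Grushko.length_pos_of_closure_eq_top (G := ULift A) (hL true)
  have hB : 0 < (L false).length :=
    Grushko.length_pos_of_closure_eq_top (G := ULift B) (hL false)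
  simp only [Fintype.sum_bool, List.length_cons, List.length_nil] at hlen
  have hA' : IsCyclic (ULift A) := Grushko.isCyclic_of_length_le_one (hL true) (by omega)
  have hB' : IsCyclic (ULift B) := Grushko.isCyclic_of_length_le_one (hL false) (by omega)
  exact ⟨isCyclic_of_surjective (MulEquiv.ulift : ULift A ≃* A) MulEquiv.ulift.surjective,
    isCyclic_of_surjective (MulEquiv.ulift : ULift B ≃* B) MulEquiv.ulift.surjective⟩
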